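/- arXiv:2111.12047 — 2 statements merged into one kernel-verified Lean document; each statement's English description precedes it below -/
import Mathlib

section
/- Let V be a C^∞ inverse Jacobi multiplier of X defined on a neighborhood of the origin of ℝ³ which is not flat at the origin. Then there exist an integer m ≥ 0 and a real constant α ≠ 0 such that the homogeneous Taylor polynomial of V at the origin vanishes in every degree k ≤ m and the homogeneous Taylor polynomial of V at the origin of degree m+1 equals α·y^m·z; that is, the lowest-degree nonzero homogeneous term of the Taylor series of V at the origin is α·y^m·z. -/
/-- Partial derivative of `f : ℝ^k → ℝ` in the `i`-th coordinate direction at `p`. -/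
noncomputable def pd {k : ℕ} (f : (Fin k → ℝ) → ℝ) (i : Fin k) (p : Fin k → ℝ) : ℝ :=
  fderiv ℝ f p (Pi.single i 1)

section
open Filter Topology
universe u
variable {E F : Type u} [NormedAddCommGroup E] [NormedSpace ℝ E] [NormedAddCommGroup F]
  [NormedSpace ℝ F]

theorem iteratedFDeriv_fderiv_diag_apply (f : E → F) (n : ℕ) (x v : E) :
    iteratedFDeriv ℝ (n + 1) f x (fun _ => v)
      = iteratedFDeriv ℝ n (fderiv ℝ f) x (fun _ => v) v :=
  iteratedFDeriv_succ_apply_right _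

theorem ContDiffAt.fderiv_infty {f : E → F} {x : E} (hf : ContDiffAt ℝ (⊤ : ℕ∞) f x) :
    ContDiffAt ℝ (⊤ : ℕ∞) (fderiv ℝ f) x :=
  hf.fderiv_right (by simp)

theorem ContDiffAt.iteratedFDeriv_fderiv_fderiv_flip {f : E → F} {x : E}
    (hf : ContDiffAt ℝ (⊤ : ℕ∞) f x) (n : ℕ) (w : Fin n → E) (u v : E) :
    iteratedFDeriv ℝ n (fderiv ℝ (fderiv ℝ f)) x w u v
      = iteratedFDeriv ℝ n (fderiv ℝ (fderiv ℝ f)) x w v u := by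
  let L : (E →L[ℝ] E →L[ℝ] F) →L[ℝ] (E →L[ℝ] E →L[ℝ] F) :=
    (ContinuousLinearMap.flipₗᵢ ℝ E E F).toContinuousLinearEquiv
  have hsymm : fderiv ℝ (fderiv ℝ f) =ᶠ[𝓝 x] L ∘ fderiv ℝ (fderiv ℝ f) := by
    have h2 : ContDiffAt ℝ 2 f x := contDiffAt_infty.1 hf 2
    filter_upwards [h2.eventually (by simp)] with y hy
    ext a b
    exact (hy.isSymmSndFDerivAt (by simp)).eq a b
  have hc := ContinuousLinearMap.iteratedFDeriv_comp_left (𝕜 := ℝ) (E := E)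
    (F := E →L[ℝ] E →L[ℝ] F) (G := E →L[ℝ] E →L[ℝ] F) L
    (contDiffAt_infty.1 hf.fderiv_infty.fderiv_infty n)
    (i := n) le_rfl
  conv_lhs => rw [(hsymm.iteratedFDeriv ℝ n).self_of_nhds.trans hc]
  rfl

theorem ContDiffAt.hasFDerivAt_iteratedFDeriv_diag {f : E → F} {x : E}
    (hf : ContDiffAt ℝ (⊤ : ℕ∞) f x) (n : ℕ) (v : E) :
    HasFDerivAt (fun v => iteratedFDeriv ℝ (n + 1) f x (fun _ => v))
      ((n + 1 : ℝ) • iteratedFDeriv ℝ n (fderiv ℝ f) x (fun _ => v)) v := by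
  induction n generalizing F with
  | zero =>
    simpa [iteratedFDeriv_fderiv_diag_apply] using (fderiv ℝ f x).hasFDerivAt
  | succ n ih =>
    simp only [iteratedFDeriv_fderiv_diag_apply f]
    convert! (ih hf.fderiv_infty).clm_apply (hasFDerivAt_id v) using 1
    ext u
    simp [hf.iteratedFDeriv_fderiv_fderiv_flip n _ u v,
      iteratedFDeriv_fderiv_diag_apply (fderiv ℝ f)]
    module

theorem ContDiffAt.iteratedFDeriv_eq_zero_of_diag {f : E → F} {x : E}
    (hf : ContDiffAt ℝ (⊤ : ℕ∞) f x) (n : ℕ)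
    (h : ∀ v, iteratedFDeriv ℝ n f x (fun _ => v) = 0) : iteratedFDeriv ℝ n f x = 0 := by
  induction n generalizing F with
  | zero =>
    ext w
    rw [Subsingleton.elim w fun _ => 0, h]
    rfl
  | succ n ih =>
    rw [← norm_eq_zero, ← norm_iteratedFDeriv_fderiv, norm_eq_zero]
    refine ih hf.fderiv_infty fun v => ?_
    have h1 := hf.hasFDerivAt_iteratedFDeriv_diag n v
    simp only [h] at h1
    have h2 := h1.unique (hasFDerivAt_const 0 v)
    exact (smul_eq_zero.1 h2).resolve_left (by positivity)

theorem ContDiffAt.isLittleO_line_sub_iteratedFDeriv {f : E → F}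
    (hf : ContDiffAt ℝ (⊤ : ℕ∞) f 0) (n : ℕ)
    (h : ∀ k < n, iteratedFDeriv ℝ k f 0 = 0) (v : E) :
    (fun t : ℝ => f (t • v) - t ^ n • (n.factorial : ℝ)⁻¹ • iteratedFDeriv ℝ n f 0 (fun _ => v))
      =o[𝓝 0] fun t => t ^ n := by
  induction n generalizing F with
  | zero =>
    have hc : ContinuousAt (fun t : ℝ => f (t • v)) 0 :=
      ContinuousAt.comp (by simpa using hf.continuousAt) (by fun_prop)
    simpa [Asymptotics.isLittleO_one_iff, tendsto_sub_nhds_zero_iff] using hc.tendsto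
  | succ n ih =>
    have ih' := ih hf.fderiv_infty fun k hk => by
      rw [← norm_eq_zero, norm_iteratedFDeriv_fderiv, norm_eq_zero]
      exact h (k + 1) (by lia)
    have hd : ∀ᶠ t : ℝ in 𝓝 0, DifferentiableAt ℝ f (t • v) := by
      have hl : Tendsto (fun t : ℝ => t • v) (𝓝 0) (𝓝 0) := by
        have : Continuous fun t : ℝ => t • v := by fun_prop
        simpa using this.tendsto 0
      have h1 : ContDiffAt ℝ 1 f 0 := contDiffAt_infty.1 hf 1
      filter_upwards [hl.eventually (h1.eventually (by simp))] with t ht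
      exact ht.differentiableAt (by simp)
    obtain ⟨ε, hε, hball⟩ := Metric.eventually_nhds_iff_ball.1 hd
    have h0 : (0 : ℝ) ∈ Metric.ball (0 : ℝ) ε := Metric.mem_ball_self hε
    have key := Convex.isLittleO_pow_succ_real (convex_ball (0 : ℝ) ε) h0
      (f := fun t : ℝ => f (t • v) - t ^ (n + 1) • ((n + 1).factorial : ℝ)⁻¹ •
        iteratedFDeriv ℝ (n + 1) f 0 (fun _ => v))
      (f' := fun t : ℝ => (fderiv ℝ f (t • v) - t ^ n • (n.factorial : ℝ)⁻¹ •
        iteratedFDeriv ℝ n (fderiv ℝ f) 0 (fun _ => v)) v) (n := n) ?_ ?_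
    · rw [nhdsWithin_eq_nhds.2 (Metric.ball_mem_nhds _ hε)] at key
      have hf0 : f 0 = 0 := by
        have := h 0 (by lia)
        rw [← norm_eq_zero, norm_iteratedFDeriv_zero, norm_eq_zero] at this
        exact this
      simpa [hf0] using key
    · intro t ht
      have h1 : HasDerivAt (fun t : ℝ => f (t • v)) (fderiv ℝ f (t • v) v) t := by
        have := (hball t ht).hasFDerivAt.comp_hasDerivAt t ((hasDerivAt_id t).smul_const v)
        simpa [Function.comp_def] using this
      have h2 := (hasDerivAt_pow (n + 1) t).smul_const (((n + 1).factorial : ℝ)⁻¹ •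
        iteratedFDeriv ℝ (n + 1) f 0 (fun _ => v))
      convert! (h1.sub h2).hasDerivWithinAt using 1
      rw [iteratedFDeriv_fderiv_diag_apply]
      simp only [sub_apply, smul_apply, smul_smul,
        Nat.factorial_succ]
      congr 2
      push_cast
      have : (n.factorial : ℝ) ≠ 0 := by positivity
      field_simp
    · rw [nhdsWithin_eq_nhds.2 (Metric.ball_mem_nhds _ hε)]
      simp only [sub_zero]
      refine Asymptotics.IsBigO.trans_isLittleO ?_ ih'
      exact (ContinuousLinearMap.apply ℝ F v).isBigO_comp (fun t : ℝ =>
        fderiv ℝ f (t • v) - t ^ n • (n.factorial : ℝ)⁻¹ •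
          iteratedFDeriv ℝ n (fderiv ℝ f) 0 (fun _ => v)) _

theorem ContDiffAt.tendsto_line_iteratedFDeriv {f : E → F}
    (hf : ContDiffAt ℝ (⊤ : ℕ∞) f 0) (n : ℕ)
    (h : ∀ k < n, iteratedFDeriv ℝ k f 0 = 0) (v : E) :
    Tendsto (fun t : ℝ => (t ^ n)⁻¹ • f (t • v)) (𝓝[≠] 0)
      (𝓝 ((n.factorial : ℝ)⁻¹ • iteratedFDeriv ℝ n f 0 (fun _ => v))) := by
  have h1 := (hf.isLittleO_line_sub_iteratedFDeriv n h v).mono (nhdsWithin_le_nhds (s := {0}ᶜ))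
  have h2 := h1.tendsto_inv_smul_nhds_zero
  rw [← tendsto_sub_nhds_zero_iff]
  refine h2.congr' ?_
  filter_upwards [self_mem_nhdsWithin] with t ht
  have : t ^ n ≠ 0 := pow_ne_zero _ ht
  rw [smul_sub, inv_smul_smul₀ this]

end

section
open MvPolynomial

theorem MvPolynomial.hasFDerivAt_eval {σ : Type*} [Fintype σ] (p : MvPolynomial σ ℝ) (v : σ → ℝ) :
    HasFDerivAt (fun v => eval v p)
      (∑ i, eval v (pderiv i p) • ContinuousLinearMap.proj (R := ℝ) (φ := fun _ => ℝ) i) v := by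
  classical
  induction p using MvPolynomial.induction_on with
  | C a => simpa using hasFDerivAt_const a v
  | add p q hp hq =>
    simp only [map_add, add_smul, Finset.sum_add_distrib]
    exact hp.add hq
  | mul_X p j hp =>
    have hX : HasFDerivAt (fun v : σ → ℝ => v j)
        (ContinuousLinearMap.proj (R := ℝ) (φ := fun _ => ℝ) j) v :=
      (ContinuousLinearMap.proj (R := ℝ) (φ := fun _ => ℝ) j).hasFDerivAt
    simp only [map_mul, eval_X]
    convert! hp.mul hX using 1
    simp [pderiv_X, Pi.single_apply, apply_ite, add_smul, Finset.sum_add_distrib, Finset.smul_sum,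
      smul_smul, ite_smul]

theorem MultilinearMap.exists_mvPolynomial_eval_diag {σ : Type*} [Fintype σ] {n : ℕ}
    (A : MultilinearMap ℝ (fun _ : Fin n => σ → ℝ) ℝ) :
    ∃ p : MvPolynomial σ ℝ, p.IsHomogeneous n ∧ ∀ v, eval v p = A fun _ => v := by
  classical
  refine ⟨∑ r : Fin n → σ, C (A fun i => Pi.single (r i) 1) * ∏ i, X (r i), ?_, fun v => ?_⟩
  · refine IsHomogeneous.sum _ _ _ fun r _ => ?_
    simpa using (isHomogeneous_C σ (A fun i => Pi.single (r i) 1)).mul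
      (IsHomogeneous.prod Finset.univ (fun i => X (r i)) (fun _ => 1)
        fun i _ => isHomogeneous_X ℝ (r i))
  · have hv : v = ∑ j, v j • (Pi.single j 1 : σ → ℝ) := by
      simpa using (pi_eq_sum_univ' v)
    conv_rhs => rw [hv]
    rw [A.map_sum]
    simp [A.map_smul_univ, mul_comm]

theorem MvPolynomial.coeff_X_mul_pderiv_self {σ : Type*} (p : MvPolynomial σ ℝ) (i : σ)
    (d : σ →₀ ℕ) : coeff d (X i * pderiv i p) = d i * coeff d p := by
  classical
  rw [coeff_X_mul', coeff_pderiv]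
  split_ifs with h
  · have h1 : 1 ≤ d i := Nat.one_le_iff_ne_zero.2 (Finsupp.mem_support_iff.1 h)
    rw [tsub_add_cancel_of_le (Finsupp.single_le_iff.2 h1)]
    simp [Nat.cast_sub h1, mul_comm]
  · simp [Finsupp.notMem_support_iff.1 h]

theorem MvPolynomial.eq_C_mul_of_shear_eigen {lam : ℝ} (hlam : lam ≠ 0)
    {p : MvPolynomial (Fin 3) ℝ} {m : ℕ} (hp : p.IsHomogeneous (m + 1))
    (h : X 1 * pderiv 0 p - C lam * (X 2 * pderiv 2 p) + C lam * p = 0) :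
    ∃ α : ℝ, p = C α * (X 1 ^ m * X 2) := by
  have hc : ∀ d : Fin 3 →₀ ℕ,
      coeff d (X 1 * pderiv 0 p) = lam * (d 2 - 1) * coeff d p := by
    intro d
    have := congrArg (coeff d) h
    simp only [coeff_add, coeff_sub, coeff_C_mul, coeff_X_mul_pderiv_self, coeff_zero] at this
    linear_combination this
  have hk : ∀ j (d : Fin 3 →₀ ℕ), d 1 = j → d 2 ≠ 1 → coeff d p = 0 := by
    intro j
    induction j with
    | zero =>
      intro d h1 h2
      have h3 := hc d
      rw [coeff_X_mul', if_neg (by simp [h1])] at h3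
      have : (d 2 : ℝ) - 1 ≠ 0 := sub_ne_zero.2 (by exact_mod_cast h2)
      simpa [hlam, this] using h3.symm
    | succ j ih =>
      intro d h1 h2
      have h3 := hc d
      rw [coeff_X_mul', if_pos (by simp [h1]), coeff_pderiv,
        ih _ (by simp [h1]) (by simpa using h2), zero_mul] at h3
      have : (d 2 : ℝ) - 1 ≠ 0 := sub_ne_zero.2 (by exact_mod_cast h2)
      simpa [hlam, this] using h3.symm
  have hi : ∀ d : Fin 3 →₀ ℕ, d 0 ≠ 0 → d 2 = 1 → coeff d p = 0 := by
    intro d h0 h2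
    have h3 := hc (Finsupp.single 1 1 + (d - Finsupp.single 0 1))
    rw [coeff_X_mul, coeff_pderiv, tsub_add_cancel_of_le
      (Finsupp.single_le_iff.2 (Nat.one_le_iff_ne_zero.2 h0))] at h3
    simp only [Finsupp.add_apply, Finsupp.tsub_apply] at h3
    simp [h2] at h3
    exact h3.resolve_right (by positivity)
  refine ⟨coeff (Finsupp.single 1 m + Finsupp.single 2 1) p, ?_⟩
  have hm : (X 1 ^ m * X 2 : MvPolynomial (Fin 3) ℝ) =
      monomial (Finsupp.single 1 m + Finsupp.single 2 1) 1 := by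
    rw [X_pow_eq_monomial, X, monomial_mul, one_mul]
  ext d
  rw [hm, coeff_C_mul, coeff_monomial]
  split_ifs with hd
  · simp [hd]
  · rw [mul_zero]
    by_contra hne
    have h2 : d 2 = 1 := by_contra fun h => hne (hk _ d rfl h)
    have h0 : d 0 = 0 := by_contra fun h => hne (hi d h h2)
    have hdeg : d.degree = m + 1 := by_contra fun h => hne (hp.coeff_eq_zero h)
    rw [Finsupp.degree_eq_sum] at hdeg
    simp [Fin.sum_univ_three, h0, h2] at hdeg
    apply hd
    ext i
    fin_cases i <;> simp [h0, h2, hdeg]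
end

/-- Any non-flat `C^∞` inverse Jacobi multiplier `V` of the nilpotent vector field
`X = (y + P, Q, −λz + R)` has lowest-degree nonzero Taylor homogeneous term `α·y^m·z`. -/
theorem inverseJacobiMultiplier_lowest_term
    (lam : ℝ) (hlam : lam ≠ 0)
    (U : Set (Fin 3 → ℝ)) (hUopen : IsOpen U) (hU0 : (0 : Fin 3 → ℝ) ∈ U)
    (P Q R : (Fin 3 → ℝ) → ℝ)
    (hP : ContDiffOn ℝ (⊤ : ℕ∞) P U) (hQ : ContDiffOn ℝ (⊤ : ℕ∞) Q U) (hR : ContDiffOn ℝ (⊤ : ℕ∞) R U)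
    (hP0 : P 0 = 0) (hdP0 : fderiv ℝ P 0 = 0)
    (hQ0 : Q 0 = 0) (hdQ0 : fderiv ℝ Q 0 = 0)
    (hR0 : R 0 = 0) (hdR0 : fderiv ℝ R 0 = 0)
    (U' : Set (Fin 3 → ℝ)) (hU'open : IsOpen U') (hU'0 : (0 : Fin 3 → ℝ) ∈ U')
    (hU'U : U' ⊆ U)
    (V : (Fin 3 → ℝ) → ℝ) (hV : ContDiffOn ℝ (⊤ : ℕ∞) V U')
    -- `V` is not identically zero on any open subset of its domain
    (hVnz : ∀ O : Set (Fin 3 → ℝ), O ⊆ U' → IsOpen O → O.Nonempty → ∃ p ∈ O, V p ≠ 0)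
    -- `V` is an inverse Jacobi multiplier: `XV − V·div X ≡ 0`
    (hmult : ∀ p ∈ U',
      (p 1 + P p) * pd V 0 p + Q p * pd V 1 p + (-lam * p 2 + R p) * pd V 2 p
        - V p * (pd P 0 p + pd Q 1 p + (-lam + pd R 2 p)) = 0)
    -- `V` is not flat at the origin
    (hnotflat : ∃ k : ℕ, iteratedFDeriv ℝ k V 0 ≠ 0) :
    ∃ (m : ℕ) (α : ℝ), α ≠ 0 ∧
      (∀ k ≤ m, iteratedFDeriv ℝ k V 0 = 0) ∧
      (∀ v : Fin 3 → ℝ,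
        (((m + 1).factorial : ℝ))⁻¹ * iteratedFDeriv ℝ (m + 1) V 0 (fun _ => v)
          = α * (v 1) ^ m * v 2) := by
  open Filter Topology MvPolynomial in
  classical
  have hV' : ContDiffAt ℝ (⊤ : ℕ∞) V 0 := hV.contDiffAt (hU'open.mem_nhds hU'0)
  have hP' : ContDiffAt ℝ (⊤ : ℕ∞) P 0 := hP.contDiffAt (hUopen.mem_nhds hU0)
  have hQ' : ContDiffAt ℝ (⊤ : ℕ∞) Q 0 := hQ.contDiffAt (hUopen.mem_nhds hU0)
  have hR' : ContDiffAt ℝ (⊤ : ℕ∞) R 0 := hR.contDiffAt (hUopen.mem_nhds hU0)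
  have hn : iteratedFDeriv ℝ (Nat.find hnotflat) V 0 ≠ 0 := Nat.find_spec hnotflat
  have hlow : ∀ k < Nat.find hnotflat, iteratedFDeriv ℝ k V 0 = 0 :=
    fun k hk => not_not.1 (Nat.find_min hnotflat hk)
  obtain ⟨m, hm⟩ : ∃ m, Nat.find hnotflat = m + 1 := by
    refine Nat.exists_eq_succ_of_ne_zero fun h0 => hn ?_
    rw [h0, ← norm_eq_zero, norm_iteratedFDeriv_zero, norm_eq_zero]
    simpa [pd, hP0, hQ0, hR0, hdP0, hdQ0, hdR0, hlam] using hmult 0 hU'0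
  rw [hm] at hn hlow
  obtain ⟨p, hp, hpA⟩ :=
    (iteratedFDeriv ℝ (m + 1) V 0).toMultilinearMap.exists_mvPolynomial_eval_diag
  replace hpA : ∀ v, eval v p = iteratedFDeriv ℝ (m + 1) V 0 fun _ => v := hpA
  have hpd : ∀ v i, eval v (pderiv i p) =
      (m + 1) * iteratedFDeriv ℝ m (fderiv ℝ V) 0 (fun _ => v) (Pi.single i 1) := by
    intro v i
    have h1 := hV'.hasFDerivAt_iteratedFDeriv_diag m v
    simp only [← hpA] at h1
    have h2 := congrArg (fun L => L (Pi.single i 1)) ((p.hasFDerivAt_eval v).unique h1)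
    simpa [Pi.single_apply] using h2
  have hpde : X 1 * pderiv 0 p - C lam * (X 2 * pderiv 2 p) + C lam * p = 0 := by
    refine MvPolynomial.funext fun v => ?_
    simp only [map_add, map_sub, map_mul, eval_X, eval_C, map_zero, hpd, hpA]
    have hVlim := hV'.tendsto_line_iteratedFDeriv (m + 1) hlow v
    have hdVlim : ∀ i, Tendsto (fun t : ℝ => (t ^ m)⁻¹ * pd V i (t • v)) (𝓝[≠] 0)
        (𝓝 ((m.factorial : ℝ)⁻¹ *
          iteratedFDeriv ℝ m (fderiv ℝ V) 0 (fun _ => v) (Pi.single i 1))) := fun i => by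
      have h := hV'.fderiv_infty.tendsto_line_iteratedFDeriv m (fun k hk => by
        rw [← norm_eq_zero, norm_iteratedFDeriv_fderiv, norm_eq_zero]
        exact hlow (k + 1) (by lia)) v
      simpa [pd, Function.comp_def] using
        ((ContinuousLinearMap.apply ℝ ℝ (Pi.single i 1)).continuous.tendsto _).comp h
    have hlin : ∀ f : (Fin 3 → ℝ) → ℝ, ContDiffAt ℝ (⊤ : ℕ∞) f 0 → f 0 = 0 → fderiv ℝ f 0 = 0 →
        Tendsto (fun t : ℝ => t⁻¹ * f (t • v)) (𝓝[≠] 0) (𝓝 0) := fun f hf hf0 hdf0 => by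
      have h := hf.tendsto_line_iteratedFDeriv 1 (fun k hk => by
        rw [Nat.lt_one_iff.1 hk, ← norm_eq_zero, norm_iteratedFDeriv_zero, hf0, norm_zero]) v
      simpa [hdf0] using h
    have hdiv : ∀ f : (Fin 3 → ℝ) → ℝ, ContDiffAt ℝ (⊤ : ℕ∞) f 0 → fderiv ℝ f 0 = 0 → ∀ i,
        Tendsto (fun t : ℝ => pd f i (t • v)) (𝓝[≠] 0) (𝓝 0) := fun f hf hdf0 i => by
      have h := hf.fderiv_infty.tendsto_line_iteratedFDeriv 0 (by simp) v
      simpa [pd, hdf0, Function.comp_def] using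
        ((ContinuousLinearMap.apply ℝ ℝ (Pi.single i 1)).continuous.tendsto _).comp h
    have hlim := (((((hlin P hP' hP0 hdP0).const_add (v 1)).mul (hdVlim 0)).add
      ((hlin Q hQ' hQ0 hdQ0).mul (hdVlim 1))).add
      (((hlin R hR' hR0 hdR0).const_add (-lam * v 2)).mul (hdVlim 2))).sub
      (hVlim.mul (((hdiv P hP' hdP0 0).add (hdiv Q hQ' hdQ0 1)).add
        ((hdiv R hR' hdR0 2).const_add (-lam))))
    have hmem : ∀ᶠ t : ℝ in 𝓝[≠] 0, t • v ∈ U' := by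
      have hc : Continuous fun t : ℝ => t • v := by fun_prop
      refine nhdsWithin_le_nhds (hc.tendsto 0 (hU'open.mem_nhds ?_))
      simpa using hU'0
    have hzero := hlim.congr' (f₂ := fun _ => (0 : ℝ)) (by
      filter_upwards [hmem, self_mem_nhdsWithin] with t ht ht0
      have ht0' : t ≠ 0 := ht0
      have h := hmult _ ht
      simp only [Pi.smul_apply, smul_eq_mul] at h ⊢
      rw [pow_succ]
      field_simp
      linear_combination h)
    have heq := tendsto_nhds_unique hzero tendsto_const_nhds
    have hfac : (m.factorial : ℝ) ≠ 0 := by positivity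
    simp only [Nat.factorial_succ, Nat.cast_mul, Nat.cast_succ, smul_eq_mul] at heq
    field_simp at heq
    linear_combination heq
  obtain ⟨α, hα⟩ := eq_C_mul_of_shear_eigen hlam hp hpde
  have hdiag : ∀ v : Fin 3 → ℝ,
      iteratedFDeriv ℝ (m + 1) V 0 (fun _ => v) = α * (v 1 ^ m * v 2) := fun v => by
    rw [← hpA, hα]
    simp
  have hfac : ((m + 1).factorial : ℝ) ≠ 0 := by positivity
  refine ⟨m, ((m + 1).factorial : ℝ)⁻¹ * α, mul_ne_zero (inv_ne_zero hfac) fun h0 => hn ?_,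
    fun k hk => hlow k (by lia), fun v => ?_⟩
  · exact hV'.iteratedFDeriv_eq_zero_of_diag (m + 1) fun v => by simp [hdiag, h0]
  · rw [hdiag]
    ring
end

section
/- Let h be a C^∞ function on a neighborhood W of the origin of ℝ² with h(0,0) = 0 and Dh(0,0) = 0, whose graph z = h(x,y) is invariant for X, in the sense that ∂h/∂x·(y + P(x,y,h(x,y))) + ∂h/∂y·Q(x,y,h(x,y)) = −λ·h(x,y) + R(x,y,h(x,y)) on W, and let V be a C^∞ inverse Jacobi multiplier of X defined on a neighborhood of the origin of ℝ³. Then the restriction u(x,y) = V(x,y,h(x,y)) is flat at the origin, i.e., all iterated derivatives of u at (0,0) vanish. -/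
/-- The point `(x, y, h(x,y))` of the graph of `h` over `w = (x,y)`. -/
def emb (h : (Fin 2 → ℝ) → ℝ) (w : Fin 2 → ℝ) : Fin 3 → ℝ := ![w 0, w 1, h w]

open scoped ContDiff Topology

section VanishingOrder

variable {E : Type*} [NormedAddCommGroup E] [NormedSpace ℝ E] {f g : E → ℝ} {x : E} {m n : ℕ}

/-- `f` is smooth at `x` and its derivatives at `x` of order less than `m` vanish. -/
structure VanishesToOrder (m : ℕ) (f : E → ℝ) (x : E) : Prop where
  contDiffAt : ContDiffAt ℝ ∞ f x
  iteratedFDeriv_eq_zero : ∀ k < m, iteratedFDeriv ℝ k f x = 0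

namespace VanishesToOrder

theorem of_contDiffAt (hf : ContDiffAt ℝ ∞ f x) : VanishesToOrder 0 f x :=
  ⟨hf, fun _ hk => absurd hk (Nat.not_lt_zero _)⟩

theorem one (hf : ContDiffAt ℝ ∞ f x) (h0 : f x = 0) : VanishesToOrder 1 f x := by
  refine ⟨hf, fun k hk => ?_⟩
  obtain rfl : k = 0 := by omega
  rw [← norm_eq_zero, norm_iteratedFDeriv_zero, h0, norm_zero]

theorem two (hf : ContDiffAt ℝ ∞ f x) (h0 : f x = 0) (h1 : fderiv ℝ f x = 0) :
    VanishesToOrder 2 f x := by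
  refine ⟨hf, fun k hk => ?_⟩
  obtain rfl | rfl : k = 0 ∨ k = 1 := by omega
  · exact (one hf h0).iteratedFDeriv_eq_zero 0 one_pos
  · rw [← norm_eq_zero, norm_iteratedFDeriv_one, h1, norm_zero]

theorem mono (hf : VanishesToOrder m f x) (hnm : n ≤ m) : VanishesToOrder n f x :=
  ⟨hf.contDiffAt, fun k hk => hf.iteratedFDeriv_eq_zero k (hk.trans_le hnm)⟩

theorem congr (hf : VanishesToOrder m f x) (hfg : g =ᶠ[𝓝 x] f) : VanishesToOrder m g x :=
  ⟨hf.contDiffAt.congr_of_eventuallyEq hfg, fun k hk => by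
    rw [(hfg.iteratedFDeriv ℝ k).eq_of_nhds, hf.iteratedFDeriv_eq_zero k hk]⟩

theorem add (hf : VanishesToOrder m f x) (hg : VanishesToOrder m g x) :
    VanishesToOrder m (fun y => f y + g y) x := by
  refine ⟨hf.contDiffAt.add hg.contDiffAt, fun k hk => ?_⟩
  have hle : (k : ℕ∞ω) ≤ ∞ := mod_cast le_top
  have := iteratedFDeriv_add_apply (hf.contDiffAt.of_le hle) (hg.contDiffAt.of_le hle)
  rw [hf.iteratedFDeriv_eq_zero k hk, hg.iteratedFDeriv_eq_zero k hk, add_zero] at this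
  exact this

theorem mul (hf : VanishesToOrder m f x) (hg : VanishesToOrder n g x) :
    VanishesToOrder (m + n) (fun y => f y * g y) x := by
  refine ⟨hf.contDiffAt.mul hg.contDiffAt, fun k hk => ?_⟩
  have hle : (k : ℕ∞ω) ≤ ∞ := mod_cast le_top
  obtain ⟨u, hu, hxu, hfu⟩ := (hf.contDiffAt.of_le hle).contDiffOn' le_rfl (by simp)
  obtain ⟨v, hv, hxv, hgv⟩ := (hg.contDiffAt.of_le hle).contDiffOn' le_rfl (by simp)
  simp only [Set.insert_eq_of_mem, Set.mem_univ, Set.univ_inter] at hfu hgv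
  have hs : IsOpen (u ∩ v) := hu.inter hv
  have hxs : x ∈ u ∩ v := ⟨hxu, hxv⟩
  have key := norm_iteratedFDerivWithin_mul_le (hfu.mono Set.inter_subset_left)
    (hgv.mono Set.inter_subset_right) hs.uniqueDiffOn hxs le_rfl
  simp only [iteratedFDerivWithin_of_isOpen _ hs hxs] at key
  rw [← norm_le_zero_iff]
  refine key.trans (Finset.sum_nonpos fun i hi => ?_)
  rcases lt_or_ge i m with him | him
  · rw [hf.iteratedFDeriv_eq_zero i him]
    simp
  · rw [hg.iteratedFDeriv_eq_zero (k - i) (by grind)]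
    simp

theorem const_mul (c : ℝ) (hf : VanishesToOrder m f x) :
    VanishesToOrder m (fun y => c * f y) x := by
  simpa using (of_contDiffAt (contDiffAt_const (c := c))).mul hf

theorem fderiv_apply (hf : VanishesToOrder m f x) (v : E) :
    VanishesToOrder (m - 1) (fun y => fderiv ℝ f y v) x := by
  have hd : ContDiffAt ℝ ∞ (fderiv ℝ f) x := hf.contDiffAt.fderiv_right (by simp)
  refine ⟨hd.clm_apply contDiffAt_const, fun k hk => ?_⟩
  have key := norm_iteratedFDeriv_clm_apply_const (c := v) hd (n := k) (mod_cast le_top)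
  rw [norm_iteratedFDeriv_fderiv, hf.iteratedFDeriv_eq_zero (k + 1) (by omega), norm_zero,
    mul_zero] at key
  exact norm_le_zero_iff.1 key

/-- If `f - ℓ · ∂ᵥf` vanishes to order `m` at a zero of the linear form `ℓ`, and `ℓ v = 0`,
then `f` vanishes to order `m`. -/
theorem of_sub_mul_fderiv (ℓ : E →L[ℝ] ℝ) (v : E) (hv : ℓ v = 0) (hx : ℓ x = 0)
    (hf : ContDiffAt ℝ ∞ f x)
    (hm : VanishesToOrder m (fun y => f y - ℓ y * fderiv ℝ f y v) x) :
    VanishesToOrder m f x := by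
  induction m generalizing f with
  | zero => exact of_contDiffAt hf
  | succ m ih =>
    have hd : ContDiffAt ℝ ∞ (fun y => fderiv ℝ f y v) x :=
      ((of_contDiffAt hf).fderiv_apply v).contDiffAt
    have hfv : VanishesToOrder m (fun y => fderiv ℝ f y v) x := by
      refine ih hd ((hm.fderiv_apply v).congr ?_)
      have h1 := (hf.of_le (m := 1) (mod_cast le_top)).eventually (by simp)
      have h2 := (hd.of_le (m := 1) (mod_cast le_top)).eventually (by simp)
      filter_upwards [h1, h2] with y hy hy'
      have hdy := hy.differentiableAt one_ne_zero
      have hdy' := hy'.differentiableAt one_ne_zero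
      have key : fderiv ℝ (fun y => f y - ℓ y * fderiv ℝ f y v) y = _ :=
        (hdy.hasFDerivAt.sub (ℓ.hasFDerivAt.mul hdy'.hasFDerivAt)).fderiv
      rw [key]
      simp [hv]
    have hℓ : VanishesToOrder 1 ℓ x := one ℓ.contDiff.contDiffAt hx
    exact (hm.add ((hℓ.mul hfv).mono (by omega))).congr (.of_forall fun y => by simp)

end VanishesToOrder

/-- Smooth solutions of `(ℓ + p) ∂ᵥu + q ∂_w u = c u` are flat at a point where `c ≠ 0`, `ℓ`
vanishes, and `p`, `q` vanish to second order, provided that the linear form `ℓ` kills `v`. -/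
theorem iteratedFDeriv_eq_zero_of_nilpotent_linearPart (ℓ : E →L[ℝ] ℝ) (v w : E) (hv : ℓ v = 0)
    (hx : ℓ x = 0) {p q c u : E → ℝ} (hp : VanishesToOrder 2 p x) (hq : VanishesToOrder 2 q x)
    (hc : ContDiffAt ℝ ∞ c x) (hcx : c x ≠ 0) (hu : ContDiffAt ℝ ∞ u x)
    (heq : ∀ᶠ y in 𝓝 x,
      (ℓ y + p y) * fderiv ℝ u y v + q y * fderiv ℝ u y w = c y * u y) (k : ℕ) :
    iteratedFDeriv ℝ k u x = 0 := by
  suffices H : ∀ m, VanishesToOrder m u x from (H (k + 1)).iteratedFDeriv_eq_zero k k.lt_succ_self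
  intro m
  induction m with
  | zero => exact .of_contDiffAt hu
  | succ m ih =>
    have hc1 : VanishesToOrder 1 (fun y => c x - c y) x :=
      .one (contDiffAt_const.sub hc) (sub_self _)
    have hr := ((((hc1.mul ih).mono (n := m + 1) (by omega)).add
      ((hp.mul (ih.fderiv_apply v)).mono (by omega))).add
      ((hq.mul (ih.fderiv_apply w)).mono (by omega))).const_mul (c x)⁻¹
    refine .of_sub_mul_fderiv ((c x)⁻¹ • ℓ) v (by simp [hv]) (by simp [hx]) hu (hr.congr ?_)
    filter_upwards [heq] with y hy
    simp only [smul_apply, smul_eq_mul]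
    field_simp
    linear_combination -hy

end VanishingOrder

theorem contDiffAt_emb {h : (Fin 2 → ℝ) → ℝ} {w : Fin 2 → ℝ} {n : ℕ∞ω}
    (hh : ContDiffAt ℝ n h w) : ContDiffAt ℝ n (emb h) w := by
  rw [contDiffAt_pi]
  intro i
  fin_cases i
  · exact (contDiff_apply ℝ ℝ 0).contDiffAt
  · exact (contDiff_apply ℝ ℝ 1).contDiffAt
  · exact hh

theorem hasFDerivAt_emb {h : (Fin 2 → ℝ) → ℝ} {w : Fin 2 → ℝ} (hh : DifferentiableAt ℝ h w) :
    HasFDerivAt (emb h) (ContinuousLinearMap.pi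
      ![ContinuousLinearMap.proj 0, ContinuousLinearMap.proj 1, fderiv ℝ h w]) w := by
  rw [hasFDerivAt_pi']
  intro i
  fin_cases i
  · exact hasFDerivAt_apply 0 w
  · exact hasFDerivAt_apply 1 w
  · exact hh.hasFDerivAt

theorem fderiv_apply_eq_sum_pd {k : ℕ} (f : (Fin k → ℝ) → ℝ) (p v : Fin k → ℝ) :
    fderiv ℝ f p v = ∑ i, v i * pd f i p := by
  conv_lhs => rw [pi_eq_sum_univ' v, map_sum]
  simp [pd]

theorem emb_zero {h : (Fin 2 → ℝ) → ℝ} (hh0 : h 0 = 0) : emb h 0 = 0 := by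
  ext i
  fin_cases i <;> simp [emb, hh0]

theorem pd_comp_emb {V : (Fin 3 → ℝ) → ℝ} {h : (Fin 2 → ℝ) → ℝ} {w : Fin 2 → ℝ}
    (hV : DifferentiableAt ℝ V (emb h w)) (hh : DifferentiableAt ℝ h w) :
    pd (fun v => V (emb h v)) 0 w = pd V 0 (emb h w) + pd h 0 w * pd V 2 (emb h w) ∧
    pd (fun v => V (emb h v)) 1 w = pd V 1 (emb h w) + pd h 1 w * pd V 2 (emb h w) := by
  have key : fderiv ℝ (fun v => V (emb h v)) w = _ :=
    (hV.hasFDerivAt.comp w (hasFDerivAt_emb hh)).fderiv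
  constructor
  all_goals
    rw [pd, key, ContinuousLinearMap.comp_apply, fderiv_apply_eq_sum_pd, Fin.sum_univ_three]
    simp [pd]

theorem contDiffAt_pd {k : ℕ} {f : (Fin k → ℝ) → ℝ} {p : Fin k → ℝ} (hf : ContDiffAt ℝ ∞ f p)
    (i : Fin k) : ContDiffAt ℝ ∞ (pd f i) p :=
  ((VanishesToOrder.of_contDiffAt hf).fderiv_apply _).contDiffAt

theorem VanishesToOrder.two_comp_emb {F : (Fin 3 → ℝ) → ℝ} {h : (Fin 2 → ℝ) → ℝ}
    (hF : ContDiffAt ℝ ∞ F 0) (hF0 : F 0 = 0) (hdF0 : fderiv ℝ F 0 = 0)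
    (hh : ContDiffAt ℝ ∞ h 0) (hh0 : h 0 = 0) :
    VanishesToOrder 2 (fun w => F (emb h w)) 0 := by
  rw [← emb_zero hh0] at hF hF0 hdF0
  refine .two (hF.comp _ (contDiffAt_emb hh)) hF0 ?_
  have := (hF.differentiableAt (by simp)).hasFDerivAt.comp _
    ((contDiffAt_emb hh).differentiableAt (by simp)).hasFDerivAt
  rw [hdF0, ContinuousLinearMap.zero_comp] at this
  exact this.fderiv

/-- The restriction `u(x,y) = V(x,y,h(x,y))` of a `C^∞` inverse Jacobi multiplier `V` of
`X = (y + P, Q, −λz + R)` to an invariant center-manifold graph `z = h(x,y)` is flat at the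
origin. -/
theorem restriction_of_inverseJacobiMultiplier_flat
    (lam : ℝ) (hlam : lam ≠ 0)
    (U : Set (Fin 3 → ℝ)) (hUopen : IsOpen U) (hU0 : (0 : Fin 3 → ℝ) ∈ U)
    (P Q R : (Fin 3 → ℝ) → ℝ)
    (hP : ContDiffOn ℝ (⊤ : ℕ∞) P U) (hQ : ContDiffOn ℝ (⊤ : ℕ∞) Q U) (hR : ContDiffOn ℝ (⊤ : ℕ∞) R U)
    (hP0 : P 0 = 0) (hdP0 : fderiv ℝ P 0 = 0)
    (hQ0 : Q 0 = 0) (hdQ0 : fderiv ℝ Q 0 = 0)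
    (hR0 : R 0 = 0) (hdR0 : fderiv ℝ R 0 = 0)
    -- `h` is `C^∞` on a neighborhood `W` of the origin of `ℝ²`, `h(0,0) = 0`, `Dh(0,0) = 0`
    (W : Set (Fin 2 → ℝ)) (hWopen : IsOpen W) (hW0 : (0 : Fin 2 → ℝ) ∈ W)
    (h : (Fin 2 → ℝ) → ℝ) (hh : ContDiffOn ℝ (⊤ : ℕ∞) h W)
    (hh0 : h 0 = 0) (hdh0 : fderiv ℝ h 0 = 0)
    -- the graph `z = h(x,y)` is invariant for `X`
    (hinv : ∀ w ∈ W,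
      pd h 0 w * (w 1 + P (emb h w)) + pd h 1 w * Q (emb h w)
        = -lam * h w + R (emb h w))
    -- `V` is a `C^∞` inverse Jacobi multiplier of `X` on a neighborhood `U'` of the origin
    (U' : Set (Fin 3 → ℝ)) (hU'open : IsOpen U') (hU'0 : (0 : Fin 3 → ℝ) ∈ U')
    (hU'U : U' ⊆ U)
    (V : (Fin 3 → ℝ) → ℝ) (hV : ContDiffOn ℝ (⊤ : ℕ∞) V U')
    (hVnz : ∀ O : Set (Fin 3 → ℝ), O ⊆ U' → IsOpen O → O.Nonempty → ∃ p ∈ O, V p ≠ 0)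
    (hmult : ∀ p ∈ U',
      (p 1 + P p) * pd V 0 p + Q p * pd V 1 p + (-lam * p 2 + R p) * pd V 2 p
        - V p * (pd P 0 p + pd Q 1 p + (-lam + pd R 2 p)) = 0)
    -- the graph of `h` over `W` lies in the domain of `V`
    (hgraph : ∀ w ∈ W, emb h w ∈ U') :
    ∀ k : ℕ, iteratedFDeriv ℝ k (fun v => V (emb h v)) 0 = 0 := by
  have hsm : ∀ {F : (Fin 3 → ℝ) → ℝ}, ContDiffOn ℝ (⊤ : ℕ∞) F U → ContDiffAt ℝ ∞ F 0 :=
    fun hF => hF.contDiffAt (hUopen.mem_nhds hU0)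
  have hP' := hsm hP
  have hQ' := hsm hQ
  have hR' := hsm hR
  have hV' : ∀ p ∈ U', ContDiffAt ℝ ∞ V p := fun p hp => hV.contDiffAt (hU'open.mem_nhds hp)
  have hh' : ∀ w ∈ W, ContDiffAt ℝ ∞ h w := fun w hw => hh.contDiffAt (hWopen.mem_nhds hw)
  have hdiv : ContDiffAt ℝ ∞ (fun p => pd P 0 p + pd Q 1 p + (-lam + pd R 2 p)) (emb h 0) := by
    rw [emb_zero hh0]
    exact ((contDiffAt_pd hP' 0).add (contDiffAt_pd hQ' 1)).add (contDiffAt_const.add (contDiffAt_pd hR' 2))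
  refine iteratedFDeriv_eq_zero_of_nilpotent_linearPart
    (ContinuousLinearMap.proj (R := ℝ) (φ := fun _ : Fin 2 => ℝ) 1)
    (Pi.single 0 1) (Pi.single 1 1) (by simp) (by simp)
    (.two_comp_emb hP' hP0 hdP0 (hh' 0 hW0) hh0) (.two_comp_emb hQ' hQ0 hdQ0 (hh' 0 hW0) hh0)
    (hdiv.comp _ (contDiffAt_emb (hh' 0 hW0))) ?_ ((hV' _ (hgraph 0 hW0)).comp _ (contDiffAt_emb (hh' 0 hW0))) ?_
  · simp [emb_zero hh0, pd, hdP0, hdQ0, hdR0, hlam]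
  · filter_upwards [hWopen.mem_nhds hW0] with w hw
    obtain ⟨h0, h1⟩ := pd_comp_emb ((hV' _ (hgraph w hw)).differentiableAt (by simp))
      ((hh' w hw).differentiableAt (by simp))
    have hm := hmult _ (hgraph w hw)
    have e1 : emb h w 1 = w 1 := rfl
    have e2 : emb h w 2 = h w := rfl
    rw [e1, e2] at hm
    change (w 1 + P (emb h w)) * pd (fun v => V (emb h v)) 0 w
      + Q (emb h w) * pd (fun v => V (emb h v)) 1 w = _ * V (emb h w)
    rw [h0, h1]
    simp only [Function.comp_apply]
    linear_combination hm + pd V 2 (emb h w) * hinv w hw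
end
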